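/- Let R be a commutative Noetherian ring of prime characteristic p, let G be an x-torsion-free R-module with Frobenius-semilinear endomorphism ξ, and let 𝔠 be an ideal of R. Set N := (0 :_G 𝔠) = {g ∈ G : c·g = 0 for all c ∈ 𝔠} and, for i ∈ ℕ, N_i := {g ∈ G : c·ξ^i(g) = 0 for all c ∈ 𝔠}. Suppose v₀ ∈ ℕ satisfies N_{v₀} = N_{v₀+1}. Then N_{v₀} is the largest ξ-stable R-submodule of G contained in N: that is, ξ(N_{v₀}) ⊆ N_{v₀}, N_{v₀} ⊆ N, and every R-submodule L of G with ξ(L) ⊆ L and L ⊆ N satisfies L ⊆ N_{v₀}. -/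

import Mathlib

theorem iterate_smul_of_semilinear {R G : Type*} [Monoid R] [SMul R G] {p : ℕ} {ξ : G → G}
    (hsemi : ∀ (r : R) (g : G), ξ (r • g) = r ^ p • ξ g) (n : ℕ) (r : R) (g : G) :
    ξ^[n] (r • g) = r ^ p ^ n • ξ^[n] g := by
  induction n generalizing r g with
  | zero => simp
  | succ n ih => rw [Function.iterate_succ_apply, hsemi, ih, ← pow_mul, ← pow_succ',
      Function.iterate_succ_apply]

/-- Let `R` be a commutative Noetherian ring of prime characteristic `p`,
let `G` be an `x`-torsion-free `R`-module with Frobenius-semilinear endomorphism `ξ`, and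
let `𝔠` be an ideal of `R`.  Set `N := (0 :_G 𝔠)` and
`N_i := {g ∈ G : c • ξ^i g = 0 for all c ∈ 𝔠}`.  Suppose `v₀ ∈ ℕ` satisfies
`N_{v₀} = N_{v₀+1}`.  Then `N_{v₀}` is the largest `ξ`-stable `R`-submodule of `G`
contained in `N`. -/
theorem stmt8 (R : Type*) [CommRing R] [IsNoetherianRing R]
    (p : ℕ) (hp : p.Prime) [CharP R p]
    (G : Type*) [AddCommGroup G] [Module R G]
    (ξ : G → G)
    (hadd : ∀ a b : G, ξ (a + b) = ξ a + ξ b)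
    (hsemi : ∀ (r : R) (g : G), ξ (r • g) = r ^ p • ξ g)
    (htf : ∀ g : G, (∃ j : ℕ, 0 < j ∧ ξ^[j] g = 0) → g = 0)
    (𝔠 : Ideal R)
    (Nzero : Set G) (hNzero : Nzero = {g : G | ∀ c ∈ 𝔠, c • g = 0})
    (N : ℕ → Set G) (hN : ∀ i : ℕ, N i = {g : G | ∀ c ∈ 𝔠, c • ξ^[i] g = 0})
    (v₀ : ℕ) (hv₀ : N v₀ = N (v₀ + 1)) :
    (0 : G) ∈ N v₀ ∧
    (∀ g₁ g₂ : G, g₁ ∈ N v₀ → g₂ ∈ N v₀ → g₁ + g₂ ∈ N v₀) ∧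
    (∀ (r : R) (g : G), g ∈ N v₀ → r • g ∈ N v₀) ∧
    (∀ g ∈ N v₀, ξ g ∈ N v₀) ∧
    N v₀ ⊆ Nzero ∧
    (∀ L : Submodule R G, (∀ g ∈ L, ξ g ∈ L) → (L : Set G) ⊆ Nzero →
      (L : Set G) ⊆ N v₀) := by
  have hzero : ξ 0 = 0 := by simpa using hadd 0 0
  have hiter_zero (n : ℕ) : ξ^[n] 0 = 0 := Function.iterate_fixed hzero n
  have hiter_add (n : ℕ) (a b : G) : ξ^[n] (a + b) = ξ^[n] a + ξ^[n] b :=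
    iterate_map_add (AddMonoidHom.mk' ξ hadd) n a b
  have hinj (n : ℕ) (g : G) (hg : ξ^[n] g = 0) : g = 0 :=
    htf g ⟨n + 1, n.succ_pos, by rw [Function.iterate_succ_apply', hg, hzero]⟩
  have hmem (i : ℕ) (g : G) : g ∈ N i ↔ ∀ c ∈ 𝔠, c • ξ^[i] g = 0 := by simp [hN]
  refine ⟨?_, ?_, ?_, ?_, ?_, ?_⟩
  · simp [hmem, hiter_zero]
  · intro g₁ g₂ h₁ h₂
    rw [hmem] at *
    intro c hc
    rw [hiter_add, smul_add, h₁ c hc, h₂ c hc, add_zero]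
  · intro r g hg
    rw [hmem] at *
    intro c hc
    rw [iterate_smul_of_semilinear hsemi, smul_comm, hg c hc, smul_zero]
  · intro g hg
    rw [hv₀, hmem] at hg
    exact (hmem v₀ (ξ g)).2 hg
  · intro g hg
    rw [hNzero]
    intro c hc
    apply hinj v₀
    rw [iterate_smul_of_semilinear hsemi]
    exact (hmem v₀ g).1 hg _ (Ideal.pow_mem_of_mem 𝔠 hc _ (pow_pos hp.pos _))
  · intro L hL hLN g hg
    rw [hmem]
    have hgL : ξ^[v₀] g ∈ (L : Set G) :=
      Set.MapsTo.iterate (f := ξ) (s := (L : Set G)) hL v₀ hg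
    simpa [hNzero] using hLN hgL
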